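/- arXiv:2001.09143 — 11 statements merged into one kernel-verified Lean document; each statement's English description precedes it below -/
import Mathlib

section
/- Let L be a frame. Then L is infinitely De Morgan (IDM) if and only if for every indexed family {aᵢ} in L with ⨅ᵢ aᵢ = ⊥ one has ⨆ᵢ aᵢ* = ⊤. -/
universe u

/-- A frame is infinitely De Morgan (IDM) iff every indexed family with infimum `⊥`
has the suprema of the pseudocomplements equal to `⊤`. -/
theorem idm_iff_inf_bot_imp_sup_compl_top {L : Type u} [Order.Frame L] :
    (∀ {ι : Type u} (a : ι → L), (⨅ i, a i)ᶜ ≤ ⨆ i, (a i)ᶜ) ↔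
      (∀ {ι : Type u} (a : ι → L), (⨅ i, a i) = ⊥ → (⨆ i, (a i)ᶜ) = ⊤) := by
  refine ⟨fun h ι a ha => ?_, fun h ι a => ?_⟩
  · have := h a
    rwa [ha, compl_bot, top_le_iff] at this
  · cases isEmpty_or_nonempty ι
    · rw [iInf_of_isEmpty, sInf_empty, compl_top]
      exact bot_le
    · have hinf : (⨅ i, a i ⊓ (⨅ j, a j)ᶜ) = ⊥ := by
        rw [← iInf_inf, inf_compl_self]
      rw [← inf_top_eq (⨅ i, a i)ᶜ, ← h _ hinf, inf_iSup_eq]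
      refine iSup_mono fun i => ?_
      rw [le_compl_iff_disjoint_right, disjoint_iff, inf_right_comm,
        inf_comm _ (a i), inf_compl_self]
end

section
/- Let X be a topological space. The frame of open sets of X is infinitely De Morgan (IDM) if and only if for every indexed family {Cᵢ} of closed subsets of X whose union is dense in X, the union of the interiors ⋃ᵢ int(Cᵢ) equals X. -/
universe u

open TopologicalSpace

/-- The complements of a family of open sets have dense union iff the family has infimum `⊥`. -/
theorem dense_iUnion_compl_iff_iInf_eq_bot {X : Type*} {ι : Sort*} [TopologicalSpace X]
    (a : ι → Opens X) : Dense (⋃ i, (a i : Set X)ᶜ) ↔ ⨅ i, a i = ⊥ := by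
  rw [← Set.compl_iInter, ← interior_eq_empty_iff_dense_compl, eq_bot_iff,
    ← Set.subset_empty_iff]
  constructor
  · intro h x hx
    refine h (interior_maximal ?_ (⨅ i, a i).isOpen hx)
    exact Set.subset_iInter fun i => iInf_le a i
  · intro h x hx
    have hle : Opens.interior (⋂ i, (a i : Set X)) ≤ ⨅ i, a i :=
      le_iInf fun i => interior_subset.trans (Set.iInter_subset _ i)
    exact h (hle hx)

/-- A frame is infinitely De Morgan iff the law holds for families with infimum `⊥`. -/
theorem compl_iInf_le_iSup_compl_iff_of_iInf_eq_bot {L : Type*} [Order.Frame L] :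
    (∀ {ι : Type u} (a : ι → L), (⨅ i, a i)ᶜ ≤ ⨆ i, (a i)ᶜ) ↔
      ∀ {ι : Type u} (a : ι → L), ⨅ i, a i = ⊥ → ⨆ i, (a i)ᶜ = ⊤ := by
  constructor
  · intro h ι a ha
    simpa [ha] using h a
  · intro h ι a
    have hb := h (fun o : Option ι => o.elim (⨅ i, a i)ᶜ a) (by simp [iInf_option])
    simp only [iSup_option, Option.elim_none, Option.elim_some] at hb
    calc (⨅ i, a i)ᶜ = (⨅ i, a i)ᶜ ⊓ ((⨅ i, a i)ᶜᶜ ⊔ ⨆ i, (a i)ᶜ) := by rw [hb, inf_top_eq]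
      _ = (⨅ i, a i)ᶜ ⊓ ⨆ i, (a i)ᶜ := by rw [inf_sup_left, inf_compl_self, bot_sup_eq]
      _ ≤ ⨆ i, (a i)ᶜ := inf_le_right

/-- A topological space is IDM iff for each family of closed sets with dense union,
the family of their interiors covers the space. -/
theorem opens_idm_iff_closed_dense_union_interiors_cover {X : Type u} [TopologicalSpace X] :
    (∀ {ι : Type u} (a : ι → Opens X), (⨅ i, a i)ᶜ ≤ ⨆ i, (a i)ᶜ) ↔
      (∀ {ι : Type u} (C : ι → Set X), (∀ i, IsClosed (C i)) → Dense (⋃ i, C i) →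
        (⋃ i, interior (C i)) = Set.univ) := by
  rw [compl_iInf_le_iSup_compl_iff_of_iInf_eq_bot]
  have key {ι : Type u} (a : ι → Opens X) :
      ⨆ i, (a i)ᶜ = ⊤ ↔ ⋃ i, interior (a i : Set X)ᶜ = Set.univ := by
    rw [← SetLike.coe_set_eq, Opens.coe_iSup, Opens.coe_top]
    simp only [Opens.coe_compl_eq_interior_compl]
  constructor
  · intro h ι C hC hd
    let a : ι → Opens X := fun i => ⟨(C i)ᶜ, (hC i).isOpen_compl⟩
    have ha (i : ι) : (a i : Set X)ᶜ = C i := compl_compl (C i)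
    simpa only [ha] using
      (key a).1 (h a ((dense_iUnion_compl_iff_iInf_eq_bot a).1 (by simpa only [ha] using hd)))
  · intro h ι a ha
    exact (key a).2 (h _ (fun i => (a i).isOpen.isClosed_compl)
      ((dense_iUnion_compl_iff_iInf_eq_bot a).2 ha))
end

section
/- Let L be a frame. Then L is a Boolean algebra (i.e. a** = a for every a ∈ L) if and only if L is weakly subfit and infinitely De Morgan (IDM). -/
universe u

section Frame

variable {L : Type u} [Order.Frame L]

theorem sup_compl_eq_top_of_compl_compl (h : ∀ a : L, aᶜᶜ = a) (a : L) : a ⊔ aᶜ = ⊤ := by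
  rw [← h (a ⊔ aᶜ), compl_sup, inf_compl_self, compl_bot]

theorem compl_iInf_le_of_compl_compl (h : ∀ a : L, aᶜᶜ = a) {ι : Type u} (a : ι → L) :
    (⨅ i, a i)ᶜ ≤ ⨆ i, (a i)ᶜ := by
  rw [← h (⨆ i, (a i)ᶜ)]
  refine compl_le_compl (le_iInf fun i => ?_)
  rw [← h (a i)]
  exact compl_le_compl (le_iSup (fun i => (a i)ᶜ) i)

/-- In an infinitely De Morgan frame, the meet of all dense elements is dense. -/
theorem compl_iInf_dense_eq_bot
    (hI : ∀ {ι : Type u} (a : ι → L), (⨅ i, a i)ᶜ ≤ ⨆ i, (a i)ᶜ) :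
    (⨅ d : {d : L // dᶜ = ⊥}, (d : L))ᶜ = ⊥ :=
  le_bot_iff.1 ((hI _).trans (iSup_le fun d => d.2.le))

/-- In an infinitely De Morgan frame, a dense join of pseudocomplements is the top element. -/
theorem iSup_compl_eq_top
    (hI : ∀ {ι : Type u} (a : ι → L), (⨅ i, a i)ᶜ ≤ ⨆ i, (a i)ᶜ)
    {ι : Type u} (a : ι → L) (h : (⨆ i, (a i)ᶜ)ᶜ = ⊥) : ⨆ i, (a i)ᶜ = ⊤ := by
  have hle : ⨆ i, (a i)ᶜ ≤ (⨅ i, a i)ᶜ := iSup_le fun i => compl_le_compl (iInf_le a i)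
  have hbot : ⨅ i, a i = ⊥ :=
    le_bot_iff.1 (le_compl_compl.trans ((compl_le_compl hle).trans h.le))
  have := hI a
  rwa [hbot, compl_bot, top_le_iff] at this

theorem iInf_dense_eq_top
    (hW : ∀ a : L, a ≠ ⊥ → ∃ c : L, c ≠ ⊤ ∧ c ⊔ a = ⊤)
    (hI : ∀ {ι : Type u} (a : ι → L), (⨅ i, a i)ᶜ ≤ ⨆ i, (a i)ᶜ) :
    ⨅ d : {d : L // dᶜ = ⊥}, (d : L) = ⊤ := by
  have hm := compl_iInf_dense_eq_bot hI
  have hleast : ∀ d : L, dᶜ = ⊥ → ⨅ d : {d : L // dᶜ = ⊥}, (d : L) ≤ d :=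
    fun d hd => iInf_le (fun d : {d : L // dᶜ = ⊥} => (d : L)) ⟨d, hd⟩
  generalize ⨅ d : {d : L // dᶜ = ⊥}, (d : L) = m at hm hleast ⊢
  let k : L := ⨆ x : {x : L // xᶜ ≤ m}, (x : L)ᶜ
  have hdisj : m ⊓ kᶜ = ⊥ := by
    by_contra hne
    obtain ⟨c, hc, hcov⟩ := hW _ hne
    have hcle : cᶜ ≤ m ⊓ kᶜ := by
      refine (disjoint_compl_left (a := c)).le_of_codisjoint ?_
      rwa [codisjoint_iff]
    have hck : cᶜ ≤ k := le_iSup (fun x : {x : L // xᶜ ≤ m} => (x : L)ᶜ)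
      ⟨c, hcle.trans inf_le_left⟩
    have hcd : cᶜ = ⊥ := le_bot_iff.1
      ((le_inf hck (hcle.trans inf_le_right)).trans (inf_compl_self k).le)
    exact hc (hcov ▸ (sup_eq_left.2 (inf_le_left.trans (hleast c hcd))).symm)
  have hk : kᶜ = ⊥ := by
    rw [← le_bot_iff, ← hm]
    exact le_compl_iff_disjoint_left.2 (disjoint_iff.2 hdisj)
  rw [← top_le_iff, ← iSup_compl_eq_top hI _ hk]
  exact iSup_le fun x => x.2

end Frame

/-- A frame is a (complete) Boolean algebra iff it is weakly subfit and IDM. -/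
theorem boolean_iff_weaklySubfit_and_idm {L : Type u} [Order.Frame L] :
    (∀ a : L, aᶜᶜ = a) ↔
      ((∀ a : L, a ≠ ⊥ → ∃ c : L, c ≠ ⊤ ∧ c ⊔ a = ⊤) ∧
        (∀ {ι : Type u} (a : ι → L), (⨅ i, a i)ᶜ ≤ ⨆ i, (a i)ᶜ)) := by
  constructor
  · refine fun h => ⟨fun a ha => ⟨aᶜ, fun hc => ha ?_, ?_⟩, compl_iInf_le_of_compl_compl h⟩
    · rw [← h a, hc, compl_top]
    · rw [sup_comm, sup_compl_eq_top_of_compl_compl h]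
  · rintro ⟨hW, hI⟩ a
    have hd : (a ⊔ aᶜ)ᶜ = ⊥ := by rw [compl_sup, inf_compl_self]
    have htop : a ⊔ aᶜ = ⊤ := by
      rw [← top_le_iff, ← iInf_dense_eq_top hW hI]
      exact iInf_le (fun d : {d : L // dᶜ = ⊥} => (d : L)) ⟨_, hd⟩
    refine le_antisymm ?_ le_compl_compl
    refine (disjoint_compl_left (a := aᶜ)).le_of_codisjoint ?_
    rwa [codisjoint_iff, sup_comm]
end

section
/- Let L be a frame. The following are equivalent: (i) L is infinitely extremally disconnected (IED), i.e. (⨆ᵢ aᵢ)** ≤ ⨆ᵢ aᵢ** for every indexed family {aᵢ} in L; (ii) (⨅ᵢ aᵢ)* ≤ ⨆ᵢ aᵢ* for every indexed family {aᵢ} of regular elements of L; (iii) for every indexed family {aᵢ} in L with (⨆ᵢ aᵢ)* = ⊥ one has ⨆ᵢ aᵢ** = ⊤. -/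
universe u

lemma compl_iSup_eq_iInf_compl {L : Type*} [Order.Frame L] {ι : Sort*} (a : ι → L) :
    (⨆ i, a i)ᶜ = ⨅ i, (a i)ᶜ :=
  eq_of_forall_le_iff fun b => by
    simp only [le_iInf_iff, le_compl_iff_disjoint_left, disjoint_iff, iSup_inf_eq, iSup_eq_bot]

/-- Characterizations of infinitely extremally disconnected (IED) frames. -/
theorem ied_tfae {L : Type u} [Order.Frame L] :
    List.TFAE
      [ ∀ {ι : Type u} (a : ι → L), (⨆ i, a i)ᶜᶜ ≤ ⨆ i, (a i)ᶜᶜ,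
        ∀ {ι : Type u} (a : ι → L), (∀ i, (a i)ᶜᶜ = a i) →
          (⨅ i, a i)ᶜ ≤ ⨆ i, (a i)ᶜ,
        ∀ {ι : Type u} (a : ι → L), (⨆ i, a i)ᶜ = ⊥ → (⨆ i, (a i)ᶜᶜ) = ⊤ ] := by
  tfae_have 1 → 2 := by
    intro h ι a ha
    have := h fun i => (a i)ᶜ
    simpa only [compl_iSup_eq_iInf_compl, ha] using this
  tfae_have 2 → 1 := by
    intro h ι a
    rw [compl_iSup_eq_iInf_compl]
    exact h (fun i => (a i)ᶜ) fun i => compl_compl_compl (a i)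
  tfae_have 1 → 3 := by
    intro h ι a ha
    have := h a
    rwa [ha, compl_bot, top_le_iff] at this
  tfae_have 3 → 1 := by
    intro h ι a
    have key := h (fun o : Option ι => o.elim (⨆ i, a i)ᶜ a) (by
      simp only [iSup_option, Option.elim_none, Option.elim_some, compl_sup]
      exact compl_inf_self _)
    simp only [iSup_option, Option.elim_none, Option.elim_some, compl_compl_compl] at key
    exact disjoint_compl_left.le_of_codisjoint (codisjoint_iff.2 key)
  tfae_finish
end

section
/- Let L be a frame. Then L is a Boolean algebra (i.e. a** = a for every a ∈ L) if and only if L is semiregular and infinitely extremally disconnected (IED). -/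
universe u

/-- A frame is a (complete) Boolean algebra iff it is semiregular and IED. -/
theorem boolean_iff_semiregular_and_ied {L : Type u} [Order.Frame L] :
    (∀ a : L, aᶜᶜ = a) ↔
      ((∀ a : L, a = sSup {b : L | b ≤ a ∧ bᶜᶜ = b}) ∧
        (∀ {ι : Type u} (a : ι → L), (⨆ i, a i)ᶜᶜ ≤ ⨆ i, (a i)ᶜᶜ)) := by
  refine ⟨fun h => ⟨fun a => ?_, fun a => by simp only [h, le_refl]⟩, fun ⟨hsr, hied⟩ a => ?_⟩
  · exact le_antisymm (le_sSup ⟨le_rfl, h a⟩) (sSup_le fun b hb => hb.1)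
  · refine le_antisymm ?_ le_compl_compl
    have ha : a = ⨆ b : {b : L | b ≤ a ∧ bᶜᶜ = b}, (b : L) := (hsr a).trans (sSup_eq_iSup' _)
    calc aᶜᶜ = (⨆ b : {b : L | b ≤ a ∧ bᶜᶜ = b}, (b : L))ᶜᶜ := congrArg (fun x => xᶜᶜ) ha
      _ ≤ ⨆ b : {b : L | b ≤ a ∧ bᶜᶜ = b}, (b : L)ᶜᶜ := hied _
      _ ≤ a := iSup_le fun b => b.2.2.trans_le b.2.1
end

section
/- Let L be a frame such that the set B_L of regular elements of L is a locally finite family, i.e. there exists a family {bⱼ} with ⨆ⱼ bⱼ = ⊤ such that for each j the set {a ∈ B_L | a ⊓ bⱼ ≠ ⊥} is finite. If L is extremally disconnected (i.e. (a ⊓ b)* = a* ⊔ b* for all a, b ∈ L), then L is infinitely extremally disconnected (IED). -/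
universe u

/-- In an extremally disconnected frame, finite joins of regular elements are regular. -/
theorem compl_compl_sSup_of_finite {L : Type u} [Order.Frame L]
    (hED : ∀ a b : L, (a ⊓ b)ᶜ = aᶜ ⊔ bᶜ) {T : Set L} (hT : T.Finite)
    (hreg : ∀ t ∈ T, tᶜᶜ = t) : (sSup T)ᶜᶜ = sSup T := by
  induction T, hT using Set.Finite.induction_on with
  | empty => simp
  | @insert r T _ _ ih =>
    rw [sSup_insert, compl_sup, hED, hreg r (Set.mem_insert r T),
      ih fun t ht => hreg t (Set.mem_insert_of_mem r ht)]

/-- If the Booleanization (the set of regular elements) of a frame is a locally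
finite family, then extremal disconnectedness implies infinite extremal
disconnectedness. -/
theorem ed_imp_ied_of_locallyFinite_booleanization {L : Type u} [Order.Frame L]
    (hlf : ∃ (κ : Type u) (b : κ → L), (⨆ j, b j) = ⊤ ∧
      ∀ j, {a : L | aᶜᶜ = a ∧ a ⊓ b j ≠ ⊥}.Finite)
    (hED : ∀ a b : L, (a ⊓ b)ᶜ = aᶜ ⊔ bᶜ) :
    ∀ {ι : Type u} (a : ι → L), (⨆ i, a i)ᶜᶜ ≤ ⨆ i, (a i)ᶜᶜ := by
  obtain ⟨κ, b, hb, hfin⟩ := hlf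
  intro ι a
  rw [← inf_top_eq (⨆ i, a i)ᶜᶜ, ← hb, inf_iSup_eq]
  refine iSup_le fun j => ?_
  let T : Set L := {r | rᶜᶜ = r ∧ r ⊓ b j ≠ ⊥} ∩ Set.range fun i => (a i)ᶜᶜ
  have hT : (sSup T)ᶜᶜ = sSup T :=
    compl_compl_sSup_of_finite hED ((hfin j).inter_of_left _) fun t ht => ht.1.1
  have hle : (⨆ i, a i) ⊓ b j ≤ sSup T := by
    rw [iSup_inf_eq]
    refine iSup_le fun i => (inf_le_inf_right (b j) le_compl_compl).trans ?_
    by_cases h : (a i)ᶜᶜ ⊓ b j = ⊥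
    · exact h.le.trans bot_le
    · exact inf_le_left.trans
        (le_sSup ⟨⟨congrArg compl (compl_compl_compl (a i)), h⟩, i, rfl⟩)
  calc (⨆ i, a i)ᶜᶜ ⊓ b j ≤ (⨆ i, a i)ᶜᶜ ⊓ (b j)ᶜᶜ := inf_le_inf_left _ le_compl_compl
    _ = ((⨆ i, a i) ⊓ b j)ᶜᶜ := (compl_compl_inf_distrib _ _).symm
    _ ≤ (sSup T)ᶜᶜ := compl_le_compl (compl_le_compl hle)
    _ = sSup T := hT
    _ ≤ ⨆ i, (a i)ᶜᶜ := sSup_le_sSup Set.inter_subset_right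
end

section
/- Let L be a frame. The following are equivalent: (i) (a ⊓ b)* = a* ⊔ b* for all a, b ∈ L; (ii) for all a, b ∈ L with a ⊓ b = ⊥ one has a* ⊔ b* = ⊤; (iii) (a ⊔ b)** = a** ⊔ b** for all a, b ∈ L; (iv) (a ⊓ b)* ≤ a* ⊔ b* for all regular a, b ∈ L; (v) for all a, b ∈ L with (a ⊔ b)* = ⊥ one has a** ⊔ b** = ⊤. -/
/-- Characterizations of extremally disconnected (De Morgan) frames. -/
theorem extremallyDisconnected_tfae {L : Type*} [Order.Frame L] :
    List.TFAE
      [ ∀ a b : L, (a ⊓ b)ᶜ = aᶜ ⊔ bᶜ,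
        ∀ a b : L, a ⊓ b = ⊥ → aᶜ ⊔ bᶜ = ⊤,
        ∀ a b : L, (a ⊔ b)ᶜᶜ = aᶜᶜ ⊔ bᶜᶜ,
        ∀ a b : L, aᶜᶜ = a → bᶜᶜ = b → (a ⊓ b)ᶜ ≤ aᶜ ⊔ bᶜ,
        ∀ a b : L, (a ⊔ b)ᶜ = ⊥ → aᶜᶜ ⊔ bᶜᶜ = ⊤ ] := by
  tfae_have 1 → 3 := fun h a b => by rw [compl_sup, h]
  tfae_have 1 → 4 := fun h a b _ _ => (h a b).le
  tfae_have 3 → 5 := fun h a b hab => by rw [← h, hab, compl_bot]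
  tfae_have 5 → 2 := fun h a b hab => by
    have key := h aᶜ bᶜ (by rw [compl_sup, ← compl_compl_inf_distrib, hab, compl_bot, compl_top])
    rwa [compl_compl_compl, compl_compl_compl] at key
  tfae_have 4 → 2 := fun h a b hab => by
    have key := h aᶜᶜ bᶜᶜ (compl_compl_compl _) (compl_compl_compl _)
    rwa [← compl_compl_inf_distrib, hab, compl_compl_compl, compl_compl_compl,
      compl_compl_compl, compl_bot, top_le_iff] at key
  tfae_have 2 → 1 := fun h a b => by
    refine le_antisymm ?_ compl_sup_compl_le
    have key : ((a ⊓ b)ᶜ ⊓ a)ᶜ ⊔ bᶜ = ⊤ := h _ _ (by rw [inf_assoc, compl_inf_self])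
    calc
      (a ⊓ b)ᶜ = (a ⊓ b)ᶜ ⊓ (((a ⊓ b)ᶜ ⊓ a)ᶜ ⊔ bᶜ) := by rw [key, inf_top_eq]
      _ = (a ⊓ b)ᶜ ⊓ ((a ⊓ b)ᶜ ⊓ a)ᶜ ⊔ (a ⊓ b)ᶜ ⊓ bᶜ := inf_sup_left _ _ _
      _ ≤ aᶜ ⊔ bᶜ := by
        refine sup_le_sup ?_ inf_le_right
        rw [le_compl_iff_disjoint_right, disjoint_iff, inf_right_comm, inf_compl_self]
  tfae_finish
end

section
/- Let X be a T₀ topological space. Then the frame of open sets of X is ⊥-scattered (i.e. ⨅ᵢ Uᵢ** ≤ (⨅ᵢ Uᵢ)** for every indexed family {Uᵢ} of opens, where the infimum of a family of opens is the interior of its intersection and U** is the interior of the closure of U) if and only if the set of isolated points of X is dense in X. -/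
universe u

open TopologicalSpace

/-- If an open set `V` lies in `W ⊔ Wᶜ` for every open `W` of a `T₀` space, then every point
of `V` is isolated. -/
theorem isOpen_singleton_of_forall_le_sup_compl {X : Type u} [TopologicalSpace X] [T0Space X]
    {V : Opens X} (hV : ∀ W : Opens X, V ≤ W ⊔ Wᶜ) {x : X} (hx : x ∈ V) :
    IsOpen ({x} : Set X) := by
  have mem_or (W : Opens X) {y : X} (hy : y ∈ V) : y ∈ W ∨ y ∈ Wᶜ := by
    simpa using hV W hy
  have not_both (W : Opens X) {y : X} (hy : y ∈ W) (hyc : y ∈ Wᶜ) : False := by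
    have h : y ∈ W ⊓ Wᶜ := ⟨hy, hyc⟩
    rwa [inf_compl_self] at h
  let O : Opens X := ⟨(closure {x})ᶜ, isClosed_closure.isOpen_compl⟩
  have hxO : x ∈ Oᶜ := (mem_or O hx).resolve_left fun h => h (subset_closure rfl)
  have key : ((Oᶜ ⊓ V : Opens X) : Set X) = {x} := by
    refine Set.Subset.antisymm ?_ (Set.singleton_subset_iff.2 ⟨hxO, hx⟩)
    rintro y ⟨hyO, hyV⟩
    have hy : y ∈ closure {x} := by
      by_contra h
      exact not_both O h hyO
    have hspec (W : Opens X) (h : y ∈ W) : x ∈ W := by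
      obtain ⟨z, hz, rfl⟩ := mem_closure_iff.1 hy W W.isOpen h
      exact hz
    refine (inseparable_iff_forall_isOpen.2 fun s hs => ⟨hspec ⟨s, hs⟩, fun hxs => ?_⟩).eq
    exact (mem_or ⟨s, hs⟩ hyV).resolve_right fun h => not_both ⟨s, hs⟩ hxs (hspec _ h)
  exact key ▸ (Oᶜ ⊓ V).isOpen

/-- An isolated point of `Uᶜᶜ` lies in `U`. -/
theorem mem_of_mem_compl_compl_of_isOpen_singleton {X : Type u} [TopologicalSpace X]
    {U : Opens X} {x : X} (hx : IsOpen ({x} : Set X)) (h : x ∈ Uᶜᶜ) : x ∈ U := by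
  by_contra hxU
  have hle : (⟨{x}, hx⟩ : Opens X) ≤ Uᶜ := by
    rw [le_compl_iff_disjoint_right, disjoint_iff_inf_le]
    rintro y ⟨hyx, hy⟩
    rw [Set.mem_singleton_iff.1 hyx] at hy
    exact (hxU hy).elim
  have hbot : x ∈ Uᶜ ⊓ Uᶜᶜ := ⟨hle rfl, h⟩
  rwa [inf_compl_self] at hbot

/-- For a `T₀` space, the frame of opens is `⊥`-scattered iff the set of isolated
points is dense. -/
theorem opens_botScattered_iff_dense_isolated {X : Type u} [TopologicalSpace X] [T0Space X] :
    (∀ {ι : Type u} (U : ι → Opens X), (⨅ i, (U i)ᶜᶜ) ≤ (⨅ i, U i)ᶜᶜ) ↔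
      Dense {x : X | IsOpen ({x} : Set X)} := by
  constructor
  · intro h
    let D : Opens X := ⨅ W : {W : Opens X // Wᶜ = ⊥}, W.1
    have hD : Dᶜ = ⊥ := by
      have htop : (⊤ : Opens X) ≤ Dᶜᶜ :=
        le_trans (le_iInf fun W => by rw [W.2, compl_bot])
          (h fun W : {W : Opens X // Wᶜ = ⊥} => W.1)
      rw [← compl_compl_compl, top_le_iff.1 htop, compl_top]
    have hle (W : Opens X) : D ≤ W ⊔ Wᶜ :=
      iInf_le (fun W : {W : Opens X // Wᶜ = ⊥} => W.1)
        ⟨W ⊔ Wᶜ, by rw [compl_sup, inf_compl_self]⟩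
    rw [dense_iff_inter_open]
    intro G hG ⟨y, hy⟩
    by_contra hne
    have hdisj : (⟨G, hG⟩ : Opens X) ≤ Dᶜ := by
      rw [le_compl_iff_disjoint_right, disjoint_iff_inf_le]
      rintro x ⟨hxG, hxD⟩
      exact (hne ⟨x, hxG, isOpen_singleton_of_forall_le_sup_compl hle hxD⟩).elim
    rw [hD] at hdisj
    exact hdisj hy
  · intro h ι U
    rw [le_compl_iff_disjoint_right, disjoint_iff_inf_le]
    intro y hy
    obtain ⟨x, ⟨hxV, hxc⟩, hx⟩ := dense_iff_inter_open.1 h _ (Opens.isOpen _) ⟨y, hy⟩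
    have hxU : (⟨{x}, hx⟩ : Opens X) ≤ ⨅ i, U i := by
      refine le_iInf fun i => ?_
      intro z hz
      rw [Set.mem_singleton_iff.1 hz]
      exact mem_of_mem_compl_compl_of_isOpen_singleton hx
        (iInf_le (fun i => (U i)ᶜᶜ) i hxV)
    have hbot : x ∈ (⨅ i, U i) ⊓ (⨅ i, U i)ᶜ := ⟨hxU rfl, hxc⟩
    rw [inf_compl_self] at hbot
    exact hbot.elim
end

section
/- Let L be an infinitely extremally disconnected (IED) frame and let a ∈ L. Then the open sublocale ↓a is IED; concretely, the pseudocomplement in ↓a of b ≤ a is b* ⊓ a and its double pseudocomplement is b** ⊓ a, and for every nonempty indexed family {bᵢ} with bᵢ ≤ a for all i one has (⨆ᵢ bᵢ)** ⊓ a = ⨆ᵢ (bᵢ** ⊓ a). -/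
universe u

/-- If `L` is IED, then any open sublocale `↓a` is IED: the pseudocomplement in `↓a`
of `b ≤ a` is `bᶜ ⊓ a` (the greatest `x ≤ a` with `x ⊓ b = ⊥`), its double
pseudocomplement in `↓a` is `bᶜᶜ ⊓ a`, and for every nonempty family `{bᵢ}` of
elements below `a` the IED identity holds in `↓a`. -/
theorem ied_open_sublocale {L : Type u} [Order.Frame L]
    (hIED : ∀ {ι : Type u} (a : ι → L), (⨆ i, a i)ᶜᶜ ≤ ⨆ i, (a i)ᶜᶜ) (a : L) :
    (∀ b : L, b ≤ a → IsGreatest {x : L | x ≤ a ∧ x ⊓ b = ⊥} (bᶜ ⊓ a)) ∧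
    (∀ b : L, b ≤ a → (bᶜ ⊓ a)ᶜ ⊓ a = bᶜᶜ ⊓ a) ∧
    (∀ {ι : Type u} [Nonempty ι] (b : ι → L), (∀ i, b i ≤ a) →
      (⨆ i, b i)ᶜᶜ ⊓ a = ⨆ i, ((b i)ᶜᶜ ⊓ a)) := by
  refine ⟨fun b _ => ⟨⟨inf_le_right, ?_⟩, fun x hx => ?_⟩, fun b _ => ?_, fun {ι} _ b _ => ?_⟩
  · exact ((disjoint_compl_left (a := b)).mono_left inf_le_left).eq_bot
  · exact le_inf (disjoint_iff.2 hx.2).le_compl_right hx.1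
  · refine le_antisymm (le_inf ?_ inf_le_right) (inf_le_inf_right a (compl_anti inf_le_left))
    refine Disjoint.le_compl_right (disjoint_iff_inf_le.2 ?_)
    rw [inf_assoc, inf_comm a]
    exact (disjoint_compl_left (a := bᶜ ⊓ a)).le_bot
  · rw [← iSup_inf_eq]
    exact congrArg (· ⊓ a) (le_antisymm (hIED b)
      (iSup_le fun i => compl_anti (compl_anti (le_iSup b i))))
end

section
/- Let L be a frame. Then L is infinitely extremally disconnected (IED) if and only if the set B_L of regular elements of L is closed under arbitrary suprema taken in L, i.e. for every subset S of L with s** = s for all s ∈ S, one has (sSup S)** = sSup S (so that B_L is a subframe of L). -/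
universe u

/-- A frame is IED iff its Booleanization (the set of regular elements) is closed
under arbitrary suprema taken in `L`, i.e. it is a subframe of `L`. -/
theorem ied_iff_regulars_closed_under_sSup {L : Type u} [Order.Frame L] :
    (∀ {ι : Type u} (a : ι → L), (⨆ i, a i)ᶜᶜ ≤ ⨆ i, (a i)ᶜᶜ) ↔
      (∀ S : Set L, (∀ s ∈ S, sᶜᶜ = s) → (sSup S)ᶜᶜ = sSup S) := by
  constructor
  · intro h S hS
    refine le_antisymm ?_ le_compl_compl
    rw [sSup_eq_iSup']
    refine (h fun s : S => (s : L)).trans (iSup_mono fun s => ?_)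
    exact (hS s s.2).le
  · intro h ι a
    have regular : (⨆ i, (a i)ᶜᶜ)ᶜᶜ = ⨆ i, (a i)ᶜᶜ := by
      refine h (Set.range fun i => (a i)ᶜᶜ) ?_
      rintro _ ⟨i, rfl⟩
      exact compl_compl_compl (a i)ᶜ
    rw [← regular]
    exact compl_le_compl (compl_le_compl (iSup_mono fun i => le_compl_compl))
end

section
/- Let X be an infinite type equipped with the cofinite topology. Then the frame of open sets of X is infinitely extremally disconnected (IED) but not infinitely De Morgan (IDM). -/
universe u

open TopologicalSpace

/-- In a preirreducible space, nonempty open sets are dense, so their pseudocomplement is empty. -/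
theorem TopologicalSpace.Opens.compl_eq_bot_of_ne_bot {Y : Type*} [TopologicalSpace Y]
    [PreirreducibleSpace Y] {U : Opens Y} (hU : U ≠ ⊥) : Uᶜ = ⊥ := by
  by_contra h
  obtain ⟨x, hxU, hxC⟩ := nonempty_preirreducible_inter U.isOpen (Uᶜ).isOpen
    ((Opens.ne_bot_iff_nonempty _).mp hU) ((Opens.ne_bot_iff_nonempty _).mp h)
  have hx : x ∈ U ⊓ Uᶜ := ⟨hxU, hxC⟩
  rw [inf_compl_self] at hx
  exact hx

/-- The frame of opens of a preirreducible space is infinitely extremally disconnected. -/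
theorem TopologicalSpace.Opens.compl_compl_iSup_le {Y : Type*} [TopologicalSpace Y]
    [PreirreducibleSpace Y] {ι : Sort*} (a : ι → Opens Y) :
    (⨆ i, a i)ᶜᶜ ≤ ⨆ i, (a i)ᶜᶜ := by
  by_cases h : ∀ i, a i = ⊥
  · simp [h]
  · push Not at h
    obtain ⟨i, hi⟩ := h
    refine le_trans ?_ (le_iSup (fun i => (a i)ᶜᶜ) i)
    simp [Opens.compl_eq_bot_of_ne_bot hi]

/-- The open complements of points in a T₁ space have infimum `⊥`. -/
theorem TopologicalSpace.Opens.iInf_compl_singleton {Y : Type*} [TopologicalSpace Y] [T1Space Y] :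
    ⨅ x : Y, (⟨{x}ᶜ, isOpen_compl_singleton⟩ : Opens Y) = ⊥ := by
  rw [eq_bot_iff]
  intro x hx
  exact (iInf_le (fun x : Y => (⟨{x}ᶜ, isOpen_compl_singleton⟩ : Opens Y)) x hx rfl).elim

/-- The cofinite topology on an infinite set is IED but not IDM. -/
theorem cofinite_ied_not_idm {X : Type u} [Infinite X] :
    (∀ {ι : Type u} (a : ι → Opens (CofiniteTopology X)),
      (⨆ i, a i)ᶜᶜ ≤ ⨆ i, (a i)ᶜᶜ) ∧
    ¬ (∀ {ι : Type u} (a : ι → Opens (CofiniteTopology X)),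
      (⨅ i, a i)ᶜ ≤ ⨆ i, (a i)ᶜ) := by
  refine ⟨fun a => Opens.compl_compl_iSup_le a, fun h => ?_⟩
  have : Infinite (CofiniteTopology X) := Infinite.of_injective _ CofiniteTopology.of.injective
  have hne (x : CofiniteTopology X) :
      (⟨{x}ᶜ, isOpen_compl_singleton⟩ : Opens (CofiniteTopology X)) ≠ ⊥ :=
    (Opens.ne_bot_iff_nonempty _).mpr (Set.finite_singleton x).infinite_compl.nonempty
  have key := h fun x : CofiniteTopology X => ⟨{x}ᶜ, isOpen_compl_singleton⟩
  simp only [Opens.iInf_compl_singleton, Opens.compl_eq_bot_of_ne_bot (hne _), compl_bot,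
    iSup_bot] at key
  exact top_ne_bot (le_bot_iff.mp key)
end
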